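/- arXiv:1502.03123 — 15 statements merged into one kernel-verified Lean document; each statement's English description precedes it below -/
import Mathlib

section
/- Let E be a real inner product space, let g : E → ℝ be convex, and let G : E → E be a selection of subgradients of g, i.e. g(μ) ≥ g(λ) + ⟨G(λ), μ − λ⟩ for all λ, μ ∈ E. Assume there are ν ∈ [0,1] and M_ν ≥ 0 such that ‖G(λ) − G(μ)‖ ≤ M_ν · ‖λ − μ‖^ν for all λ, μ ∈ E. Then for all λ, μ ∈ E: g(μ) ≤ g(λ) + ⟨G(λ), μ − λ⟩ + (M_ν/(1+ν)) · ‖μ − λ‖^(1+ν). -/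
open scoped InnerProductSpace

/-- If `g` is convex with subgradient selection `G` that is `ν`-Hölder continuous with
constant `M_ν`, then the Hölder descent-type upper bound holds. -/
theorem holder_upper_bound
    {E : Type*} [NormedAddCommGroup E] [InnerProductSpace ℝ E]
    (g : E → ℝ) (G : E → E) (ν Mν : ℝ)
    (hg : ConvexOn ℝ Set.univ g)
    (hsub : ∀ lam mu : E, g lam + ⟪G lam, mu - lam⟫_ℝ ≤ g mu)
    (hν : ν ∈ Set.Icc (0 : ℝ) 1) (hMν : 0 ≤ Mν)
    (hHolder : ∀ lam mu : E, ‖G lam - G mu‖ ≤ Mν * ‖lam - mu‖ ^ ν) :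
    ∀ lam mu : E,
      g mu ≤ g lam + ⟪G lam, mu - lam⟫_ℝ + (Mν / (1 + ν)) * ‖mu - lam‖ ^ (1 + ν) := by
  intro x y
  obtain ⟨hν0, hν1⟩ := hν
  set d := y - x with hd
  rcases hν0.eq_or_lt with h0 | hpos
  · subst h0
    have h1 := hsub y x
    have h2 := hHolder y x
    have h3 := real_inner_le_norm (G y - G x) d
    have h4 : ⟪G y, x - y⟫_ℝ = - ⟪G y, d⟫_ℝ := by
      rw [← inner_neg_right, hd, neg_sub]
    rw [inner_sub_left] at h3
    simp only [Real.rpow_zero, mul_one] at h2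
    have h5 := mul_le_mul_of_nonneg_right h2 (norm_nonneg d)
    simp only [add_zero, div_one, Real.rpow_one]
    linarith
  · set C := Mν * ‖d‖ ^ (1 + ν) with hC
    have hnd : ‖d‖ ^ (1 + ν) = ‖d‖ * ‖d‖ ^ ν := by
      rw [Real.rpow_add_of_nonneg (norm_nonneg d) zero_le_one hν0, Real.rpow_one]
    have hC0 : 0 ≤ C := by positivity
    let k : ℝ → ℝ := fun t => ⟪G (x + t • d), d⟫_ℝ
    let f : ℝ → ℝ := fun t => g (x + t • d)
    have hk : ∀ s t : ℝ, |k s - k t| ≤ C * |s - t| ^ ν := by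
      intro s t
      have h1 := abs_real_inner_le_norm (G (x + s • d) - G (x + t • d)) d
      have h2 := hHolder (x + s • d) (x + t • d)
      have h3 : x + s • d - (x + t • d) = (s - t) • d := by module
      rw [h3, norm_smul, Real.mul_rpow (norm_nonneg _) (norm_nonneg _), Real.norm_eq_abs] at h2
      rw [inner_sub_left] at h1
      refine h1.trans ((mul_le_mul_of_nonneg_right h2 (norm_nonneg d)).trans_eq ?_)
      rw [hC, hnd]; ring
    have hf : ∀ s t : ℝ, f t + (s - t) * k t ≤ f s := by
      intro s t
      have h1 := hsub (x + t • d) (x + s • d)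
      have h3 : x + s • d - (x + t • d) = (s - t) • d := by module
      rw [h3, real_inner_smul_right] at h1
      exact h1
    have hder : ∀ t, HasDerivAt f (k t) t := by
      intro t
      rw [hasDerivAt_iff_tendsto]
      have hlim : Filter.Tendsto (fun s : ℝ => C * |s - t| ^ ν) (nhds t) (nhds 0) := by
        have hc : Continuous (fun s : ℝ => C * |s - t| ^ ν) :=
          continuous_const.mul ((continuous_id.sub continuous_const).abs.rpow_const
            (fun _ => Or.inr hν0))
        have := hc.tendsto t
        simpa [Real.zero_rpow hpos.ne'] using this
      refine squeeze_zero (fun s => by positivity) (fun s => ?_) hlim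
      have h1 := hf s t
      have h2 := hf t s
      have h3 : |f s - f t - (s - t) * k t| ≤ |s - t| * |k s - k t| := by
        rw [abs_of_nonneg (by linarith), ← abs_mul]
        refine le_trans ?_ (le_abs_self _)
        linarith
      rw [Real.norm_eq_abs, Real.norm_eq_abs, smul_eq_mul]
      rcases eq_or_ne s t with rfl | hst
      · simp
        positivity
      · have hp : 0 < |s - t| := abs_pos.mpr (sub_ne_zero.mpr hst)
        rw [inv_mul_le_iff₀ hp]
        exact h3.trans (mul_le_mul_of_nonneg_left (hk s t) hp.le)
    let B : ℝ → ℝ := fun t => g x + t * k 0 + C / (1 + ν) * t ^ (1 + ν)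
    have hB : ∀ t, HasDerivAt B (k 0 + C * t ^ ν) t := by
      intro t
      have h1 := (Real.hasDerivAt_rpow_const (x := t) (p := 1 + ν)
        (Or.inr (by linarith))).const_mul (C / (1 + ν))
      have h2 := (((hasDerivAt_id t).mul_const (k 0)).const_add (g x)).add h1
      refine h2.congr_deriv ?_
      have : 1 + ν ≠ 0 := by positivity
      rw [add_sub_cancel_left]
      field_simp
    have key := image_le_of_deriv_right_le_deriv_boundary (f := f) (f' := k) (a := 0) (b := 1)
      (B := B) (B' := fun t => k 0 + C * t ^ ν)
      (fun t _ => (hder t).continuousAt.continuousWithinAt)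
      (fun t _ => (hder t).hasDerivWithinAt)
      (by simp [f, B, Real.zero_rpow (show 1 + ν ≠ 0 by positivity)])
      (fun t _ => (hB t).continuousAt.continuousWithinAt)
      (fun t _ => (hB t).hasDerivWithinAt)
      (fun t ht => by
        have h1 := (le_abs_self _).trans (hk t 0)
        rw [sub_zero, abs_of_nonneg ht.1] at h1
        linarith)
      (Set.right_mem_Icc.mpr zero_le_one)
    have hxy : x + d = y := by rw [hd]; abel
    simp only [f, B, k, one_smul, zero_smul, add_zero, one_mul, Real.one_rpow, mul_one, hxy] at key
    refine key.trans_eq ?_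
    rw [hC]; ring
end

section
/- Let E be a real inner product space, g : E → ℝ convex with a subgradient selection G : E → E satisfying ‖G(λ) − G(μ)‖ ≤ M_ν · ‖λ − μ‖^ν for all λ, μ ∈ E, where ν ∈ [0,1] and M_ν ≥ 0. Then for every δ > 0 and every real M with M ≥ ((1−ν)/((1+ν)·δ))^((1−ν)/(1+ν)) · M_ν^(2/(1+ν)), the following holds for all λ, μ ∈ E: g(μ) ≤ g(λ) + ⟨G(λ), μ − λ⟩ + (M/2)·‖μ − λ‖² + δ/2. -/
open scoped InnerProductSpace

theorem holder_upper
    {E : Type*} [NormedAddCommGroup E] [InnerProductSpace ℝ E]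
    (g : E → ℝ) (G : E → E) (ν Mν : ℝ)
    (hg : ConvexOn ℝ Set.univ g)
    (hsub : ∀ lam mu : E, g lam + ⟪G lam, mu - lam⟫_ℝ ≤ g mu)
    (h0 : 0 ≤ ν)
    (hHolder : ∀ lam mu : E, ‖G lam - G mu‖ ≤ Mν * ‖lam - mu‖ ^ ν) (lam mu : E) :
    g mu ≤ g lam + ⟪G lam, mu - lam⟫_ℝ + Mν * ‖mu - lam‖ ^ (1 + ν) / (1 + ν) := by
  obtain ⟨h, rfl⟩ : ∃ h, mu = lam + h := ⟨mu - lam, by abel⟩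
  rw [add_sub_cancel_left]
  have hp : (1 + ν) ≠ 0 := by positivity
  set C := Mν * ‖h‖ ^ (1 + ν) with hC
  have hconv : ConvexOn ℝ Set.univ (fun t : ℝ => g (lam + t • h)) := by
    have := hg.comp_affineMap (AffineMap.lineMap lam (lam + h) : ℝ →ᵃ[ℝ] E)
    have e : (g ∘ (AffineMap.lineMap lam (lam + h) : ℝ →ᵃ[ℝ] E)) =
        (fun t : ℝ => g (lam + t • h)) := by
      funext t
      simp [AffineMap.lineMap_apply, add_comm]
    rwa [e, Set.preimage_univ] at this
  have hcont : ContinuousOn (fun t : ℝ => g (lam + t • h)) (Set.Icc 0 1) :=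
    (hconv.continuousOn isOpen_univ).mono (Set.subset_univ _)
  have hslope : ∀ z : ℝ, 0 ≤ z → ⟪G (lam + z • h), h⟫_ℝ ≤ ⟪G lam, h⟫_ℝ + C * z ^ ν := by
    intro z hz
    have h1 : ⟪G (lam + z • h) - G lam, h⟫_ℝ ≤ ‖G (lam + z • h) - G lam‖ * ‖h‖ :=
      real_inner_le_norm _ _
    have h2 := hHolder (lam + z • h) lam
    rw [add_sub_cancel_left, norm_smul, Real.norm_of_nonneg hz,
      Real.mul_rpow hz (norm_nonneg _)] at h2
    have h3 := mul_le_mul_of_nonneg_right h2 (norm_nonneg h)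
    rw [inner_sub_left] at h1
    have h4 : ‖h‖ ^ (1 + ν) = ‖h‖ * ‖h‖ ^ ν := by
      rw [Real.rpow_add_of_nonneg (norm_nonneg _) zero_le_one h0, Real.rpow_one]
    rw [hC, h4]
    nlinarith
  have key := image_le_of_liminf_slope_right_le_deriv_boundary (f := fun t : ℝ => g (lam + t • h))
    (a := 0) (b := 1) hcont
    (B := fun t => g lam + t * ⟪G lam, h⟫_ℝ + C * t ^ (1 + ν) / (1 + ν))
    (B' := fun t => ⟪G lam, h⟫_ℝ + C * t ^ ν)
    (by simp [Real.zero_rpow hp])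
    (by
      apply Continuous.continuousOn
      have : Continuous fun t : ℝ => t ^ (1 + ν) := Real.continuous_rpow_const (by positivity)
      fun_prop)
    (by
      intro x hx
      apply HasDerivAt.hasDerivWithinAt
      have h1 := Real.hasDerivAt_rpow_const (x := x) (p := 1 + ν) (Or.inr (by linarith))
      have h2 := (((hasDerivAt_id x).mul_const ⟪G lam, h⟫_ℝ).const_add (g lam)).add
        ((h1.const_mul C).div_const (1 + ν))
      convert h2 using 1
      · rfl
      rw [add_sub_cancel_left]
      field_simp)
    (by
      intro x hx r hr
      apply Filter.Eventually.frequently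
      have hc : Continuous fun t : ℝ => ⟪G lam, h⟫_ℝ + C * t ^ ν := by
        have : Continuous fun t : ℝ => t ^ ν := Real.continuous_rpow_const h0
        fun_prop
      have ev := (hc.tendsto x).eventually (gt_mem_nhds hr)
      filter_upwards [nhdsWithin_le_nhds ev, self_mem_nhdsWithin] with z hz hxz
      have hxz' : x < z := hxz
      refine lt_of_le_of_lt ?_ hz
      refine le_trans ?_ (hslope z (hx.1.trans hxz'.le))
      rw [slope_def_field, div_le_iff₀ (sub_pos.2 hxz')]
      have h5 := hsub (lam + z • h) (lam + x • h)
      have e : lam + x • h - (lam + z • h) = (x - z) • h := by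
        rw [sub_smul]; abel
      rw [e, inner_smul_right] at h5
      linarith)
  have := key (x := 1) (by simp)
  simpa using this

theorem young_step (ν Mν δ M r : ℝ) (h0 : 0 ≤ ν) (h1 : ν ≤ 1) (hMν : 0 ≤ Mν) (hδ : 0 < δ)
    (hr : 0 ≤ r)
    (hM : ((1 - ν) / ((1 + ν) * δ)) ^ ((1 - ν) / (1 + ν)) * Mν ^ (2 / (1 + ν)) ≤ M) :
    Mν * r ^ (1 + ν) / (1 + ν) ≤ (M / 2) * r ^ 2 + δ / 2 := by
  rcases h1.eq_or_lt with rfl | h1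
  · norm_num at hM ⊢
    nlinarith [mul_le_mul_of_nonneg_right hM (sq_nonneg r)]
  have hq : 0 < 1 - ν := by linarith
  have hp : 0 < 1 + ν := by linarith
  have hA : 0 ≤ (1 - ν) / ((1 + ν) * δ) := by positivity
  have hM0 : 0 ≤ M := le_trans (by positivity) hM
  have hy := Real.geom_mean_le_arith_mean2_weighted (w₁ := (1 + ν) / 2) (w₂ := (1 - ν) / 2)
    (p₁ := M * r ^ 2 / (1 + ν)) (p₂ := δ / (1 - ν)) (by positivity) (by positivity)
    (by positivity) (by positivity) (by ring)
  have e1 : (1 + ν) / 2 * (M * r ^ 2 / (1 + ν)) + (1 - ν) / 2 * (δ / (1 - ν))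
      = (M / 2) * r ^ 2 + δ / 2 := by
    field_simp
  rw [e1] at hy
  refine le_trans ?_ hy
  have hM' := Real.rpow_le_rpow (by positivity) hM (show 0 ≤ (1 + ν) / 2 by positivity)
  rw [Real.mul_rpow (by positivity) (by positivity), ← Real.rpow_mul hA, ← Real.rpow_mul hMν,
    show (1 - ν) / (1 + ν) * ((1 + ν) / 2) = (1 - ν) / 2 by field_simp,
    show 2 / (1 + ν) * ((1 + ν) / 2) = 1 by field_simp, Real.rpow_one] at hM'
  have er : (r ^ 2) ^ ((1 + ν) / 2) = r ^ (1 + ν) := by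
    rw [← Real.rpow_natCast, ← Real.rpow_mul hr]
    congr 1
    push_cast
    ring
  rw [Real.div_rpow (by positivity) hp.le, Real.mul_rpow hM0 (by positivity), er]
  have e2 : ((1 - ν) / ((1 + ν) * δ)) ^ ((1 - ν) / 2) * (δ / (1 - ν)) ^ ((1 - ν) / 2)
      = ((1 + ν) ^ ((1 - ν) / 2))⁻¹ := by
    rw [← Real.mul_rpow hA (by positivity), ← Real.inv_rpow hp.le]
    congr 1
    field_simp
  have e3 : (1 + ν) ^ ((1 + ν) / 2) * (1 + ν) ^ ((1 - ν) / 2) = 1 + ν := by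
    rw [← Real.rpow_add hp, show (1 + ν) / 2 + (1 - ν) / 2 = 1 by ring, Real.rpow_one]
  calc Mν * r ^ (1 + ν) / (1 + ν)
      = Mν * r ^ (1 + ν) / ((1 + ν) ^ ((1 + ν) / 2) * (1 + ν) ^ ((1 - ν) / 2)) := by rw [e3]
    _ = (((1 - ν) / ((1 + ν) * δ)) ^ ((1 - ν) / 2) * Mν) * r ^ (1 + ν)
          / (1 + ν) ^ ((1 + ν) / 2) * (δ / (1 - ν)) ^ ((1 - ν) / 2) := by
        rw [div_mul_eq_div_div, div_eq_mul_inv _ ((1 + ν) ^ ((1 - ν) / 2)), ← e2]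
        ring
    _ ≤ _ := by gcongr

/-- Lemma 2 of Nesterov (universal gradient methods): under `ν`-Hölder continuity of the
subgradient selection `G` of the convex function `g`, for any inexactness `δ > 0` and any
`M ≥ ((1-ν)/((1+ν)δ))^((1-ν)/(1+ν)) · M_ν^(2/(1+ν))`, the quadratic model `Q_M` is a
`δ/2`-approximate upper bound for `g`. -/
theorem approx_quadratic_upper_bound
    {E : Type*} [NormedAddCommGroup E] [InnerProductSpace ℝ E]
    (g : E → ℝ) (G : E → E) (ν Mν : ℝ)
    (hg : ConvexOn ℝ Set.univ g)
    (hsub : ∀ lam mu : E, g lam + ⟪G lam, mu - lam⟫_ℝ ≤ g mu)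
    (hν : ν ∈ Set.Icc (0 : ℝ) 1) (hMν : 0 ≤ Mν)
    (hHolder : ∀ lam mu : E, ‖G lam - G mu‖ ≤ Mν * ‖lam - mu‖ ^ ν) :
    ∀ δ : ℝ, 0 < δ →
      ∀ M : ℝ, ((1 - ν) / ((1 + ν) * δ)) ^ ((1 - ν) / (1 + ν)) * Mν ^ (2 / (1 + ν)) ≤ M →
        ∀ lam mu : E,
          g mu ≤ g lam + ⟪G lam, mu - lam⟫_ℝ + (M / 2) * ‖mu - lam‖ ^ 2 + δ / 2 := by
  intro δ hδ M hM lam mu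
  have h1 := holder_upper g G ν Mν hg hsub hν.1 hHolder lam mu
  have h2 := young_step ν Mν δ M ‖mu - lam‖ hν.1 hν.2 hMν hδ (norm_nonneg _) hM
  linarith
end

section
/- Let E be a real inner product space, g, h : E → ℝ, with h convex. Let λ̂, λ⁺, v, ξ ∈ E, M > 0, and δ ∈ ℝ. Assume: (i) ξ is a subgradient of h at λ⁺, i.e. h(μ) ≥ h(λ⁺) + ⟨ξ, μ − λ⁺⟩ for all μ ∈ E; (ii) the proximal optimality condition λ̂ − λ⁺ = (1/M)·(v + ξ) holds; (iii) the line-search condition g(λ⁺) ≤ g(λ̂) + ⟨v, λ⁺ − λ̂⟩ + (M/2)‖λ⁺ − λ̂‖² + δ/2 holds. Then for every λ ∈ E: g(λ⁺) + h(λ⁺) ≤ g(λ̂) + ⟨v, λ − λ̂⟩ + h(λ) + δ/2 + (M/2)·(‖λ − λ̂‖² − ‖λ − λ⁺‖²). -/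
open scoped InnerProductSpace

/-- Key estimate of the proximal-gradient step (Lemma 2 of the supplement): if `λ⁺` is the
proximal-gradient update from `λ̂` with constant `M`, `ξ` is a subgradient of `h` at `λ⁺`,
and the line-search condition holds with inexactness `δ`, then for every `λ` the composite
value `g(λ⁺) + h(λ⁺)` is bounded by the linearization of `g` plus `h(λ)` plus `δ/2` plus the
telescoping quadratic terms. -/
theorem prox_grad_key_estimate
    {E : Type*} [NormedAddCommGroup E] [InnerProductSpace ℝ E]
    (g h : E → ℝ) (hconv : ConvexOn ℝ Set.univ h)
    (lamhat lamplus v ξ : E) (M δ : ℝ) (hM : 0 < M)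
    (hξ : ∀ mu : E, h lamplus + ⟪ξ, mu - lamplus⟫_ℝ ≤ h mu)
    (hopt : lamhat - lamplus = (1 / M) • (v + ξ))
    (hls : g lamplus ≤ g lamhat + ⟪v, lamplus - lamhat⟫_ℝ
        + (M / 2) * ‖lamplus - lamhat‖ ^ 2 + δ / 2) :
    ∀ lam : E,
      g lamplus + h lamplus ≤ g lamhat + ⟪v, lam - lamhat⟫_ℝ + h lam + δ / 2
        + (M / 2) * (‖lam - lamhat‖ ^ 2 - ‖lam - lamplus‖ ^ 2) := by
  intro lam
  have h1 := hξ lam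
  have hx : ξ = -(M • (lamplus - lamhat)) - v := by
    have h2 : M • (lamhat - lamplus) = v + ξ := by
      rw [hopt, smul_smul, mul_one_div_cancel hM.ne', one_smul]
    have h3 : ξ = M • (lamhat - lamplus) - v := by rw [h2]; abel
    rw [h3, ← smul_neg, neg_sub]
  have e : lam - lamhat = (lam - lamplus) + (lamplus - lamhat) := by abel
  rw [e, norm_add_sq_real, inner_add_right]
  rw [hx, inner_sub_left, inner_neg_left, real_inner_smul_left,
    real_inner_comm] at h1
  linarith
end

section
/- Let E be a real inner product space, G : E → ℝ convex, ε > 0 and M̄ > 0. Let k ∈ ℕ, let λ_0, λ_1, …, λ_{k+1} ∈ E and M_0, …, M_k ∈ ℝ with 0 < M_i ≤ 2·M̄ for all i ≤ k. Assume that for every i ≤ k and every λ ∈ E: G(λ_{i+1}) ≤ G(λ) + ε/2 + (M_i/2)·(‖λ − λ_i‖² − ‖λ − λ_{i+1}‖²). Define S_k := Σ_{i=0}^{k} 1/M_i, λ̄_k := (1/S_k)·Σ_{i=0}^{k} (1/M_i)·λ_{i+1}, and Ḡ_k := (1/S_k)·Σ_{i=0}^{k} (1/M_i)·G(λ_{i+1}).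 Then for every λ ∈ E: G(λ̄_k) − G(λ) ≤ Ḡ_k − G(λ) ≤ M̄·‖λ_0 − λ‖²/(k+1) + ε/2. -/
open scoped InnerProductSpace

/-- Convergence rate of the dual objective in the universal primal-dual gradient method
(Theorem 3 in the supplement): the weighted-average dual iterate `λ̄_k` and weighted-average
objective value `Ḡ_k` satisfy `G(λ̄_k) − G(λ) ≤ Ḡ_k − G(λ) ≤ M̄ ‖λ_0 − λ‖²/(k+1) + ε/2`. -/
theorem dual_convergence_rate
    {E : Type*} [NormedAddCommGroup E] [InnerProductSpace ℝ E]
    (G : E → ℝ) (hG : ConvexOn ℝ Set.univ G)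
    (ε Mbar : ℝ) (hε : 0 < ε) (hMbar : 0 < Mbar)
    (k : ℕ) (lam : ℕ → E) (M : ℕ → ℝ)
    (hM : ∀ i ≤ k, 0 < M i ∧ M i ≤ 2 * Mbar)
    (hrec : ∀ i ≤ k, ∀ l : E,
      G (lam (i + 1)) ≤ G l + ε / 2
        + (M i / 2) * (‖l - lam i‖ ^ 2 - ‖l - lam (i + 1)‖ ^ 2)) :
    ∀ l : E,
      G ((∑ i ∈ Finset.range (k + 1), (M i)⁻¹)⁻¹ •
            ∑ i ∈ Finset.range (k + 1), (M i)⁻¹ • lam (i + 1)) - G l ≤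
        (∑ i ∈ Finset.range (k + 1), (M i)⁻¹)⁻¹ *
            (∑ i ∈ Finset.range (k + 1), (M i)⁻¹ * G (lam (i + 1))) - G l ∧
      (∑ i ∈ Finset.range (k + 1), (M i)⁻¹)⁻¹ *
            (∑ i ∈ Finset.range (k + 1), (M i)⁻¹ * G (lam (i + 1))) - G l ≤
        Mbar * ‖lam 0 - l‖ ^ 2 / ((k : ℝ) + 1) + ε / 2 := by
  intro l
  have hpos : ∀ i ∈ Finset.range (k + 1), 0 < (M i)⁻¹ := fun i hi =>
    inv_pos.mpr (hM i (Nat.lt_succ_iff.mp (Finset.mem_range.mp hi))).1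
  have hS : 0 < ∑ i ∈ Finset.range (k + 1), (M i)⁻¹ :=
    Finset.sum_pos hpos ⟨0, by simp⟩
  have hlow : ((k : ℝ) + 1) * (2 * Mbar)⁻¹ ≤ ∑ i ∈ Finset.range (k + 1), (M i)⁻¹ := by
    have h : ∑ i ∈ Finset.range (k + 1), (2 * Mbar)⁻¹ ≤ ∑ i ∈ Finset.range (k + 1), (M i)⁻¹ := by
      apply Finset.sum_le_sum
      intro i hi
      have h := hM i (Nat.lt_succ_iff.mp (Finset.mem_range.mp hi))
      exact inv_anti₀ h.1 h.2
    simpa using h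
  have hsum : ∑ i ∈ Finset.range (k + 1), (M i)⁻¹ * G (lam (i + 1)) ≤
      (∑ i ∈ Finset.range (k + 1), (M i)⁻¹) * (G l + ε / 2) + ‖lam 0 - l‖ ^ 2 / 2 := by
    have h : ∑ i ∈ Finset.range (k + 1), (M i)⁻¹ * G (lam (i + 1)) ≤
        ∑ i ∈ Finset.range (k + 1), ((M i)⁻¹ * (G l + ε / 2) -
          (‖l - lam (i + 1)‖ ^ 2 / 2 - ‖l - lam i‖ ^ 2 / 2)) := by
      apply Finset.sum_le_sum
      intro i hi
      have hi' := Nat.lt_succ_iff.mp (Finset.mem_range.mp hi)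
      have h1 := mul_le_mul_of_nonneg_left (hrec i hi' l) (hpos i hi).le
      have h2 : (M i)⁻¹ * M i = 1 := inv_mul_cancel₀ (hM i hi').1.ne'
      refine h1.trans (le_of_eq ?_)
      linear_combination (‖l - lam i‖ ^ 2 - ‖l - lam (i + 1)‖ ^ 2) / 2 * h2
    rw [Finset.sum_sub_distrib, ← Finset.sum_mul,
      Finset.sum_range_sub (fun i => ‖l - lam i‖ ^ 2 / 2)] at h
    rw [norm_sub_rev (lam 0) l]
    have := sq_nonneg ‖l - lam (k + 1)‖
    linarith
  constructor
  · have h := hG.map_centerMass_le (t := Finset.range (k + 1)) (w := fun i => (M i)⁻¹)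
      (p := fun i => lam (i + 1)) (fun i hi => (hpos i hi).le) hS (fun _ _ => Set.mem_univ _)
    simp only [Finset.centerMass, smul_eq_mul, Function.comp] at h
    linarith
  · generalize (∑ i ∈ Finset.range (k + 1), (M i)⁻¹) = S at *
    generalize (∑ i ∈ Finset.range (k + 1), (M i)⁻¹ * G (lam (i + 1))) = T at *
    have hk : (0 : ℝ) < (k : ℝ) + 1 := by positivity
    have h1 : S⁻¹ * T ≤ S⁻¹ * (S * (G l + ε / 2) + ‖lam 0 - l‖ ^ 2 / 2) :=
      mul_le_mul_of_nonneg_left hsum (inv_pos.mpr hS).le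
    have h2 : S⁻¹ ≤ (((k : ℝ) + 1) * (2 * Mbar)⁻¹)⁻¹ := inv_anti₀ (by positivity) hlow
    have h3 := mul_le_mul_of_nonneg_right h2 (by positivity : 0 ≤ ‖lam 0 - l‖ ^ 2 / 2)
    have h4 : (((k : ℝ) + 1) * (2 * Mbar)⁻¹)⁻¹ * (‖lam 0 - l‖ ^ 2 / 2) =
        Mbar * ‖lam 0 - l‖ ^ 2 / ((k : ℝ) + 1) := by
      field_simp
    rw [mul_add, inv_mul_cancel_left₀ hS.ne'] at h1
    linarith
end

section
/- Let f : ℝ^p → ℝ be convex, A : ℝ^p → ℝⁿ linear, b ∈ ℝⁿ, h : ℝⁿ → ℝ with h(0) = 0, f* ∈ ℝ, ε > 0, M̄ > 0 and k ∈ ℕ. Let x_0, …, x_k ∈ ℝ^p, λ_0, …, λ_{k+1} ∈ ℝⁿ and M_0, …, M_k ∈ ℝ with 0 < M_i ≤ 2·M̄ for all i ≤ k. Assume that for every i ≤ k and every λ ∈ ℝⁿ: f(x_i) − f* ≤ ⟨b − A x_i, λ⟩ + h(λ) + ε/2 + (M_i/2)·(‖λ − λ_i‖² − ‖λ − λ_{i+1}‖²).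 Define S_k := Σ_{i=0}^{k} 1/M_i and x̄_k := (1/S_k)·Σ_{i=0}^{k} (1/M_i)·x_i. Then f(x̄_k) − f* ≤ M̄·‖λ_0‖²/(k+1) + ε/2. -/
open scoped InnerProductSpace

/-- Objective-residual bound of Theorem 1 (UniPDGrad): the weighted-average primal iterate
`x̄_k` satisfies `f(x̄_k) − f* ≤ M̄‖λ_0‖²/(k+1) + ε/2`. -/
theorem unipdgrad_objective_residual (p n : ℕ)
    (f : EuclideanSpace ℝ (Fin p) → ℝ) (hf : ConvexOn ℝ Set.univ f)
    (A : EuclideanSpace ℝ (Fin p) →ₗ[ℝ] EuclideanSpace ℝ (Fin n))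
    (b : EuclideanSpace ℝ (Fin n))
    (h : EuclideanSpace ℝ (Fin n) → ℝ) (hh0 : h 0 = 0)
    (fstar ε Mbar : ℝ) (hε : 0 < ε) (hMbar : 0 < Mbar) (k : ℕ)
    (x : ℕ → EuclideanSpace ℝ (Fin p))
    (lam : ℕ → EuclideanSpace ℝ (Fin n)) (M : ℕ → ℝ)
    (hM : ∀ i ≤ k, 0 < M i ∧ M i ≤ 2 * Mbar)
    (hkey : ∀ i ≤ k, ∀ l : EuclideanSpace ℝ (Fin n),
      f (x i) - fstar ≤ ⟪b - A (x i), l⟫_ℝ + h l + ε / 2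
        + (M i / 2) * (‖l - lam i‖ ^ 2 - ‖l - lam (i + 1)‖ ^ 2)) :
    f ((∑ i ∈ Finset.range (k + 1), (M i)⁻¹)⁻¹ •
          ∑ i ∈ Finset.range (k + 1), (M i)⁻¹ • x i) - fstar ≤
      Mbar * ‖lam 0‖ ^ 2 / ((k : ℝ) + 1) + ε / 2 := by
  have hS : ((k : ℝ) + 1) / (2 * Mbar) ≤ ∑ i ∈ Finset.range (k + 1), (M i)⁻¹ := by
    have h1 : ∑ i ∈ Finset.range (k + 1), (2 * Mbar)⁻¹ ≤ ∑ i ∈ Finset.range (k + 1), (M i)⁻¹ := by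
      apply Finset.sum_le_sum
      intro i hi
      have hi' := hM i (by simpa [Nat.lt_succ_iff] using hi)
      exact inv_anti₀ hi'.1 hi'.2
    rw [Finset.sum_const, Finset.card_range, nsmul_eq_mul] at h1
    push_cast at h1
    rwa [div_eq_mul_inv]
  have hk : (0 : ℝ) < (k : ℝ) + 1 := by positivity
  have hS0 : 0 < ∑ i ∈ Finset.range (k + 1), (M i)⁻¹ := lt_of_lt_of_le (by positivity) hS
  have hJ := hf.map_centerMass_le (t := Finset.range (k + 1)) (w := fun i => (M i)⁻¹) (p := x)
    (fun i hi => (inv_pos.2 (hM i (by simpa [Nat.lt_succ_iff] using hi)).1).le) hS0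
    (fun i _ => Set.mem_univ _)
  simp only [Finset.centerMass, Function.comp, smul_eq_mul] at hJ
  have hsum : ∑ i ∈ Finset.range (k + 1), (M i)⁻¹ * f (x i) ≤
      ∑ i ∈ Finset.range (k + 1), ((M i)⁻¹ * (fstar + ε / 2)
        + (1 / 2) * (‖lam i‖ ^ 2 - ‖lam (i + 1)‖ ^ 2)) := by
    apply Finset.sum_le_sum
    intro i hi
    have hi' : i ≤ k := by simpa [Nat.lt_succ_iff] using hi
    have h0 := (hM i hi').1
    have h1 := hkey i hi' 0
    simp only [inner_zero_right, hh0, zero_sub, norm_neg] at h1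
    have h2 := mul_le_mul_of_nonneg_left h1 (inv_pos.2 h0).le
    have h3 : (M i)⁻¹ * M i = 1 := inv_mul_cancel₀ h0.ne'
    linear_combination h2 + (1 / 2) * (‖lam i‖ ^ 2 - ‖lam (i + 1)‖ ^ 2) * h3
  rw [Finset.sum_add_distrib, ← Finset.sum_mul, ← Finset.mul_sum,
    Finset.sum_range_sub' (fun i => ‖lam i‖ ^ 2)] at hsum
  generalize (∑ i ∈ Finset.range (k + 1), (M i)⁻¹) = S at *
  have h4 : S⁻¹ * ∑ i ∈ Finset.range (k + 1), (M i)⁻¹ * f (x i) ≤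
      fstar + ε / 2 + S⁻¹ * (1 / 2 * ‖lam 0‖ ^ 2) := by
    have h5 := mul_le_mul_of_nonneg_left hsum (inv_pos.2 hS0).le
    have h6 : S⁻¹ * S = 1 := inv_mul_cancel₀ hS0.ne'
    have h7 : 0 ≤ S⁻¹ * ‖lam (k + 1)‖ ^ 2 := by positivity
    linear_combination h5 + (fstar + ε / 2) * h6 + (1 / 2) * h7
  have h8 : S⁻¹ ≤ 2 * Mbar / ((k : ℝ) + 1) := by
    have := inv_anti₀ (by positivity) hS
    rwa [inv_div] at this
  have h9 := mul_le_mul_of_nonneg_right h8 (by positivity : 0 ≤ 1 / 2 * ‖lam 0‖ ^ 2)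
  have h10 : 2 * Mbar / ((k : ℝ) + 1) * (1 / 2 * ‖lam 0‖ ^ 2)
      = Mbar * ‖lam 0‖ ^ 2 / ((k : ℝ) + 1) := by ring
  linarith
end

section
/- Let f : ℝ^p → ℝ, A : ℝ^p → ℝⁿ linear, b ∈ ℝⁿ, X ⊆ ℝ^p, and let K ⊆ ℝⁿ be nonempty. Let f* ∈ ℝ and λ* ∈ ℝⁿ satisfy the Lagrangian saddle-point inequality f* ≤ f(x) + ⟨λ*, A x − b − r⟩ for all x ∈ X and all r ∈ K. Then for every x ∈ X: f(x) − f* ≥ −‖λ*‖ · dist(A x − b, K), where dist(u, K) := inf_{r ∈ K} ‖u − r‖. -/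
open scoped InnerProductSpace

/-- Lower bound on the objective residual via the Lagrangian saddle-point inequality:
`f(x) − f* ≥ −‖λ*‖ · dist(Ax − b, K)` for every `x ∈ X`. -/
theorem objective_residual_lower_bound (p n : ℕ)
    (f : EuclideanSpace ℝ (Fin p) → ℝ)
    (A : EuclideanSpace ℝ (Fin p) →ₗ[ℝ] EuclideanSpace ℝ (Fin n))
    (b : EuclideanSpace ℝ (Fin n))
    (X : Set (EuclideanSpace ℝ (Fin p)))
    (K : Set (EuclideanSpace ℝ (Fin n))) (hK : K.Nonempty)
    (fstar : ℝ) (lamstar : EuclideanSpace ℝ (Fin n))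
    (hsaddle : ∀ x ∈ X, ∀ r ∈ K, fstar ≤ f x + ⟪lamstar, A x - b - r⟫_ℝ) :
    ∀ x ∈ X, f x - fstar ≥ -‖lamstar‖ * Metric.infDist (A x - b) K := by
  intro x hx
  have key : ∀ r ∈ K, fstar - f x ≤ ‖lamstar‖ * dist (A x - b) r := by
    intro r hr
    have h1 := hsaddle x hx r hr
    have h2 := real_inner_le_norm lamstar (A x - b - r)
    rw [dist_eq_norm]
    linarith
  rcases (norm_nonneg lamstar).eq_or_lt with h0 | hpos
  · obtain ⟨r, hr⟩ := hK
    have := key r hr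
    rw [← h0] at this ⊢
    linarith
  · have h : (fstar - f x) / ‖lamstar‖ ≤ Metric.infDist (A x - b) K := by
      rw [Metric.le_infDist hK]
      intro r hr
      rw [div_le_iff₀' hpos]
      exact key r hr
    rw [div_le_iff₀' hpos] at h
    linarith
end

section
/- Let K ⊆ ℝⁿ be nonempty, compact and convex, and define h(λ) := max_{r ∈ K} ⟨λ, r⟩. Let f : ℝ^p → ℝ, A : ℝ^p → ℝⁿ linear, b ∈ ℝⁿ, f* ∈ ℝ, x̄ ∈ ℝ^p, λ_0, λ* ∈ ℝⁿ, S > 0, ε > 0. Assume: (i) for every λ ∈ ℝⁿ, f(x̄) − f* ≤ ⟨b − A x̄, λ⟩ + h(λ) + ε/2 + (1/(2S))·‖λ − λ_0‖²; (ii) for every r ∈ K, f* ≤ f(x̄) + ⟨λ*, A x̄ − b − r⟩. Then dist(A x̄ − b, K) ≤ (1/S)·(2‖λ_0 − λ*‖ + √(S·ε)). In particular, if in addition S ≥ (k+1)/(2M̄) for some M̄ > 0 and k ∈ ℕ, then dist(A x̄ − b, K) ≤ 4M̄·‖λ_0 − λ*‖/(k+1) + √(2M̄·ε/(k+1)). 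-/
open scoped InnerProductSpace

/-- Feasibility-gap bound of Theorem 1 (UniPDGrad): under the averaged key primal estimate
and the saddle-point inequality, `dist(Ax̄ − b, K) ≤ (1/S)(2‖λ_0 − λ*‖ + √(Sε))`, and in
particular if `S ≥ (k+1)/(2M̄)` then
`dist(Ax̄ − b, K) ≤ 4M̄‖λ_0 − λ*‖/(k+1) + √(2M̄ε/(k+1))`. -/
theorem unipdgrad_feasibility_gap (p n : ℕ)
    (K : Set (EuclideanSpace ℝ (Fin n)))
    (hKne : K.Nonempty) (hKcomp : IsCompact K) (hKconv : Convex ℝ K)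
    (h : EuclideanSpace ℝ (Fin n) → ℝ)
    (hdef : ∀ lam : EuclideanSpace ℝ (Fin n),
      IsGreatest ((fun r => ⟪lam, r⟫_ℝ) '' K) (h lam))
    (f : EuclideanSpace ℝ (Fin p) → ℝ)
    (A : EuclideanSpace ℝ (Fin p) →ₗ[ℝ] EuclideanSpace ℝ (Fin n))
    (b : EuclideanSpace ℝ (Fin n)) (fstar : ℝ)
    (xbar : EuclideanSpace ℝ (Fin p))
    (lam0 lamstar : EuclideanSpace ℝ (Fin n))
    (S ε : ℝ) (hS : 0 < S) (hε : 0 < ε)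
    (h1 : ∀ lam : EuclideanSpace ℝ (Fin n),
      f xbar - fstar ≤ ⟪b - A xbar, lam⟫_ℝ + h lam + ε / 2 + (1 / (2 * S)) * ‖lam - lam0‖ ^ 2)
    (h2 : ∀ r ∈ K, fstar ≤ f xbar + ⟪lamstar, A xbar - b - r⟫_ℝ)
    (Mbar : ℝ) (hMbar : 0 < Mbar) (k : ℕ) :
    Metric.infDist (A xbar - b) K ≤ (1 / S) * (2 * ‖lam0 - lamstar‖ + Real.sqrt (S * ε)) ∧
    (((k : ℝ) + 1) / (2 * Mbar) ≤ S →
      Metric.infDist (A xbar - b) K ≤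
        4 * Mbar * ‖lam0 - lamstar‖ / ((k : ℝ) + 1)
          + Real.sqrt (2 * Mbar * ε / ((k : ℝ) + 1))) := by
  have key : Metric.infDist (A xbar - b) K
      ≤ (1 / S) * (2 * ‖lam0 - lamstar‖ + Real.sqrt (S * ε)) := by
    obtain ⟨r, hrK, hr⟩ := exists_norm_eq_iInf_of_complete_convex hKne
      hKcomp.isComplete hKconv ((A xbar - b) + (1 / S) • lam0)
    have hproj := (norm_eq_iInf_iff_real_inner_le_zero hKconv hrK).1 hr
    have hle : Metric.infDist (A xbar - b) K ≤ ‖A xbar - b - r‖ := by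
      rw [← dist_eq_norm]
      exact Metric.infDist_le_dist_of_mem hrK
    refine hle.trans ?_
    have e1 := h1 (lam0 + S • (A xbar - b - r))
    have e2 := h2 r hrK
    have hh : h (lam0 + S • (A xbar - b - r)) ≤ ⟪lam0 + S • (A xbar - b - r), r⟫_ℝ := by
      obtain ⟨w, hwK, hw⟩ := (hdef (lam0 + S • (A xbar - b - r))).1
      rw [← hw]
      have h3 := hproj w hwK
      have h4 : lam0 + S • (A xbar - b - r) = S • ((A xbar - b) + (1 / S) • lam0 - r) := by
        simp only [smul_sub, smul_add, smul_smul, mul_one_div_cancel hS.ne', one_smul]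
        abel
      have h5 : ⟪lam0 + S • (A xbar - b - r), w - r⟫_ℝ ≤ 0 := by
        rw [h4, real_inner_smul_left]
        exact mul_nonpos_of_nonneg_of_nonpos hS.le h3
      rw [inner_sub_right] at h5
      simpa using h5
    have hb : b - A xbar = -(A xbar - b - r) - r := by abel
    rw [hb] at e1
    generalize A xbar - b - r = v at *
    have hcs : -⟪lam0 - lamstar, v⟫_ℝ ≤ ‖lam0 - lamstar‖ * ‖v‖ := by
      rw [← inner_neg_left]
      simpa only [norm_neg] using real_inner_le_norm (-(lam0 - lamstar)) v
    rw [inner_sub_left] at hcs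
    rw [add_sub_cancel_left, norm_smul, mul_pow, Real.norm_eq_abs, sq_abs, inner_sub_left,
      inner_neg_left, real_inner_comm _ r, inner_add_right v, real_inner_smul_right,
      real_inner_self_eq_norm_sq, real_inner_comm _ v] at e1
    have e3 : 1 / (2 * S) * (S ^ 2 * ‖v‖ ^ 2) = S * ‖v‖ ^ 2 / 2 := by
      field_simp
    have hq : S * ‖v‖ ^ 2 ≤ 2 * (‖lam0 - lamstar‖ * ‖v‖) + ε := by
      linarith
    have hD := norm_nonneg (lam0 - lamstar)
    have hv := norm_nonneg v
    have hs := Real.sqrt_nonneg (S * ε)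
    have hs2 := Real.sq_sqrt (mul_pos hS hε).le
    rw [one_div, inv_mul_eq_div, le_div_iff₀ hS]
    by_contra! hc
    generalize Real.sqrt (S * ε) = s at *
    generalize ‖lam0 - lamstar‖ = D at *
    generalize ‖v‖ = t at *
    have hq2 : (t * S) * (t * S - 2 * D) ≤ s ^ 2 := by
      rw [hs2]; nlinarith
    have hspos : 0 < s ^ 2 := by rw [hs2]; positivity
    nlinarith
  refine ⟨key, fun hk => key.trans ?_⟩
  have hk1 : (0 : ℝ) < (k : ℝ) + 1 := by positivity
  have hinv : 1 / S ≤ 2 * Mbar / ((k : ℝ) + 1) := by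
    rw [div_le_iff₀ (by positivity)] at hk
    rw [div_le_div_iff₀ hS hk1]
    linarith
  rw [mul_add]
  apply add_le_add
  · calc 1 / S * (2 * ‖lam0 - lamstar‖)
        ≤ 2 * Mbar / ((k : ℝ) + 1) * (2 * ‖lam0 - lamstar‖) := by gcongr
      _ = _ := by ring
  · apply Real.le_sqrt_of_sq_le
    rw [mul_pow, Real.sq_sqrt (mul_pos hS hε).le]
    calc (1 / S) ^ 2 * (S * ε) = 1 / S * ε := by field_simp
      _ ≤ 2 * Mbar / ((k : ℝ) + 1) * ε := by gcongr
      _ = _ := by ring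
end

section
/- Let E be a real inner product space. Let τ : ℕ → ℝ satisfy τ_0 = 1, τ_k > 0 for all k, and τ_{k+1}² = τ_k²·(1 − τ_{k+1}) for all k ∈ ℕ; set t_k := 1/τ_k. Let λ, λ̂, λ̃ : ℕ → E satisfy λ̃_0 = λ̂_0, and for all k ∈ ℕ: λ̂_k = (1 − τ_k)·λ_k + τ_k·λ̃_k and λ̃_{k+1} = λ̃_k − (1/τ_k)·(λ̂_k − λ_{k+1}). Then for all k ∈ ℕ: t_{k+1} = (1 + √(1 + 4·t_k²))/2, and λ̂_{k+1} = λ_{k+1} + ((t_k − 1)/t_{k+1})·(λ_{k+1} − λ_k). -/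
/-- Equivalence of the three-sequence accelerated dual scheme with the FISTA-form momentum
scheme (Lemma 4 of the supplement): with `t_k = 1/τ_k`, one has
`t_{k+1} = (1 + √(1 + 4t_k²))/2` and
`λ̂_{k+1} = λ_{k+1} + ((t_k − 1)/t_{k+1})(λ_{k+1} − λ_k)`. -/
theorem accelerated_scheme_fista_form
    {E : Type*} [NormedAddCommGroup E] [InnerProductSpace ℝ E]
    (τ : ℕ → ℝ) (hτ0 : τ 0 = 1) (hτpos : ∀ k : ℕ, 0 < τ k)
    (hτrec : ∀ k : ℕ, τ (k + 1) ^ 2 = τ k ^ 2 * (1 - τ (k + 1)))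
    (t : ℕ → ℝ) (ht : ∀ k : ℕ, t k = 1 / τ k)
    (lam lamhat lamtilde : ℕ → E)
    (h0 : lamtilde 0 = lamhat 0)
    (hhat : ∀ k : ℕ, lamhat k = (1 - τ k) • lam k + τ k • lamtilde k)
    (htilde : ∀ k : ℕ,
      lamtilde (k + 1) = lamtilde k - (1 / τ k) • (lamhat k - lam (k + 1))) :
    ∀ k : ℕ,
      t (k + 1) = (1 + Real.sqrt (1 + 4 * t k ^ 2)) / 2 ∧
      lamhat (k + 1) = lam (k + 1) + ((t k - 1) / t (k + 1)) • (lam (k + 1) - lam k) := by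
  intro k
  have ha := hτpos k
  have hb := hτpos (k + 1)
  have hr := hτrec k
  have ha' : τ k ≠ 0 := ha.ne'
  have hb' : τ (k + 1) ≠ 0 := hb.ne'
  constructor
  · have hb1 : 0 < 1 - τ (k + 1) := by
      by_contra hcon
      have h1 : 1 - τ (k + 1) ≤ 0 := not_lt.mp hcon
      have h2 : τ k ^ 2 * (1 - τ (k + 1)) ≤ 0 :=
        mul_nonpos_of_nonneg_of_nonpos (sq_nonneg _) h1
      have h3 : 0 < τ (k + 1) ^ 2 := by positivity
      linarith
    have hge : 1 ≤ t (k + 1) := by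
      rw [ht, le_div_iff₀ hb]; linarith
    have hsq : 1 + 4 * t k ^ 2 = (2 * t (k + 1) - 1) ^ 2 := by
      rw [ht, ht]
      field_simp
      linear_combination 4 * hr
    rw [hsq, Real.sqrt_sq (by linarith)]
    ring
  · rw [hhat (k + 1), htilde k, hhat k, ht, ht]
    match_scalars <;> field_simp <;> ring
end

section
/- Let E be a real inner product space, g, h : E → ℝ, G := g + h, G* ∈ ℝ, ε ∈ ℝ. Let λ_k, λ_{k+1}, λ̂_k, λ̃_k, λ̃_{k+1}, v ∈ E, τ_k ∈ ℝ with 0 < τ_k ≤ 1, and M_k > 0. Assume: (i) for every λ ∈ E, G(λ_{k+1}) ≤ g(λ̂_k) + ⟨v, λ − λ̂_k⟩ + h(λ) + τ_k·ε/2 + M_k·⟨λ̂_k − λ_{k+1}, λ̂_k − λ⟩ − (M_k/2)·‖λ_{k+1} − λ̂_k‖²; (ii) v is a subgradient of g at λ̂_k, i.e. g(λ̂_k) + ⟨v, λ − λ̂_k⟩ ≤ g(λ) for all λ ∈ E; (iii) λ̂_k = (1 − τ_k)·λ_k + τ_k·λ̃_k; (iv) λ̃_{k+1} = λ̃_k −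 (1/τ_k)·(λ̂_k − λ_{k+1}). Then for every λ ∈ E: (1/(M_k·τ_k²))·(G(λ_{k+1}) − G*) ≤ ((1 − τ_k)/(M_k·τ_k²))·(G(λ_k) − G*) + (1/2)·(‖λ̃_k − λ‖² − ‖λ̃_{k+1} − λ‖²) + ε/(2·M_k·τ_k) + (1/(M_k·τ_k))·(g(λ̂_k) + ⟨v, λ − λ̂_k⟩ + h(λ) − G*). -/
open scoped InnerProductSpace

/-- Per-iteration estimate of the accelerated universal primal-dual gradient method:
dividing the combined key estimates by `M_k τ_k²` yields the telescoping inequality used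
in the proof of Theorem 2. Here `G = g + h` and `G*` is the optimal dual value. -/
theorem accelerated_per_iteration_estimate
    {E : Type*} [NormedAddCommGroup E] [InnerProductSpace ℝ E]
    (g h : E → ℝ) (Gstar ε : ℝ)
    (lamk lamk1 lamhatk lamtildek lamtildek1 v : E) (τk Mk : ℝ)
    (hτpos : 0 < τk) (hτle : τk ≤ 1) (hMk : 0 < Mk)
    (hkey : ∀ lam : E,
      g lamk1 + h lamk1 ≤ g lamhatk + ⟪v, lam - lamhatk⟫_ℝ + h lam + τk * ε / 2
        + Mk * ⟪lamhatk - lamk1, lamhatk - lam⟫_ℝ - (Mk / 2) * ‖lamk1 - lamhatk‖ ^ 2)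
    (hsub : ∀ lam : E, g lamhatk + ⟪v, lam - lamhatk⟫_ℝ ≤ g lam)
    (hhat : lamhatk = (1 - τk) • lamk + τk • lamtildek)
    (htilde : lamtildek1 = lamtildek - (1 / τk) • (lamhatk - lamk1)) :
    ∀ lam : E,
      (1 / (Mk * τk ^ 2)) * ((g lamk1 + h lamk1) - Gstar) ≤
        ((1 - τk) / (Mk * τk ^ 2)) * ((g lamk + h lamk) - Gstar)
        + (1 / 2) * (‖lamtildek - lam‖ ^ 2 - ‖lamtildek1 - lam‖ ^ 2)
        + ε / (2 * Mk * τk)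
        + (1 / (Mk * τk)) * (g lamhatk + ⟪v, lam - lamhatk⟫_ℝ + h lam - Gstar) := by
  intro lam
  have h1 := hkey lamk
  have h2 := hkey lam
  have h3 := hsub lamk
  have hI : (1 - τk) * ⟪lamhatk - lamk1, lamhatk - lamk⟫_ℝ
      + τk * ⟪lamhatk - lamk1, lamhatk - lam⟫_ℝ
      = τk * ⟪lamhatk - lamk1, lamtildek - lam⟫_ℝ := by
    rw [← real_inner_smul_right, ← real_inner_smul_right, ← real_inner_smul_right,
      ← inner_add_right]
    congr 1
    have : (1 - τk) • (lamhatk - lamk) + τk • (lamhatk - lam)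
        = lamhatk - (1 - τk) • lamk - τk • lam := by module
    rw [this, hhat]
    module
  have hN : ‖lamtildek1 - lam‖ ^ 2 = ‖lamtildek - lam‖ ^ 2
      - 2 * ((1 / τk) * ⟪lamhatk - lamk1, lamtildek - lam⟫_ℝ)
      + (1 / τk) ^ 2 * ‖lamk1 - lamhatk‖ ^ 2 := by
    have : lamtildek1 - lam = (lamtildek - lam) - (1 / τk) • (lamhatk - lamk1) := by
      rw [htilde]; abel
    rw [this, norm_sub_sq_real, real_inner_smul_right, norm_smul, mul_pow, Real.norm_eq_abs,
      sq_abs, real_inner_comm, norm_sub_rev lamhatk lamk1]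
  rw [hN]
  generalize ⟪lamhatk - lamk1, lamtildek - lam⟫_ℝ = P at *
  generalize ⟪lamhatk - lamk1, lamhatk - lamk⟫_ℝ = A at *
  generalize ⟪lamhatk - lamk1, lamhatk - lam⟫_ℝ = B at *
  generalize ‖lamk1 - lamhatk‖ ^ 2 = D at *
  generalize ‖lamtildek - lam‖ ^ 2 = T at *
  generalize g lamhatk + ⟪v, lam - lamhatk⟫_ℝ + h lam = L at *
  have h4 : g lamk1 + h lamk1 ≤ g lamk + h lamk + τk * ε / 2 + Mk * A - Mk / 2 * D := by
    linarith
  have h5 := mul_le_mul_of_nonneg_left h4 (sub_nonneg.2 hτle)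
  have h6 := mul_le_mul_of_nonneg_left h2 hτpos.le
  have h7 : g lamk1 + h lamk1 ≤ (1 - τk) * (g lamk + h lamk) + τk * L + τk * ε / 2
      + Mk * (τk * P) - Mk / 2 * D := by
    rw [← hI]; linarith
  have h8 : 0 ≤ (1 / (Mk * τk ^ 2)) * ((1 - τk) * (g lamk + h lamk) + τk * L + τk * ε / 2
      + Mk * (τk * P) - Mk / 2 * D - (g lamk1 + h lamk1)) :=
    mul_nonneg (by positivity) (by linarith)
  rw [← sub_nonneg]
  refine h8.trans_eq ?_
  field_simp
  ring
end

section
/- Let t : ℕ → ℝ satisfy t_0 = 1 and t_{j+1} = (1 + √(1 + 4·t_j²))/2 for all j, and set τ_j := 1/t_j. Let ν ∈ [0,1], M̄ > 0, k ∈ ℕ, and let M_0, …, M_k be real numbers with 0 < M_j ≤ 2·(k+2)^((1−ν)/(1+ν))·M̄ for all j ≤ k. Then Σ_{j=0}^{k} 1/(M_j·τ_j) ≥ (k+2)^((1+3ν)/(1+ν)) / (8·M̄). -/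
/-- Lower bound on the accelerated weight sum `Ŝ_k = Σ_{j=0}^k 1/(M_j τ_j)` used in the
proof of Theorem 2: if `0 < M_j ≤ 2(k+2)^((1−ν)/(1+ν)) M̄` for all `j ≤ k`, then
`Ŝ_k ≥ (k+2)^((1+3ν)/(1+ν)) / (8M̄)`. -/
theorem accelerated_weight_sum_lower_bound
    (t : ℕ → ℝ) (h0 : t 0 = 1)
    (hrec : ∀ j : ℕ, t (j + 1) = (1 + Real.sqrt (1 + 4 * t j ^ 2)) / 2)
    (τ : ℕ → ℝ) (hτ : ∀ j : ℕ, τ j = 1 / t j)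
    (ν Mbar : ℝ) (hν : ν ∈ Set.Icc (0 : ℝ) 1) (hMbar : 0 < Mbar)
    (k : ℕ) (M : ℕ → ℝ)
    (hM : ∀ j ≤ k, 0 < M j ∧ M j ≤ 2 * ((k : ℝ) + 2) ^ ((1 - ν) / (1 + ν)) * Mbar) :
    ((k : ℝ) + 2) ^ ((1 + 3 * ν) / (1 + ν)) / (8 * Mbar) ≤
      ∑ j ∈ Finset.range (k + 1), 1 / (M j * τ j) := by
  have hge : ∀ j : ℕ, ((j : ℝ) + 2) / 2 ≤ t j := by
    intro j
    induction j with
    | zero => rw [h0]; norm_num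
    | succ n ih =>
      rw [hrec]
      have h1 : 2 * t n ≤ Real.sqrt (1 + 4 * t n ^ 2) := by
        apply Real.le_sqrt_of_sq_le
        nlinarith
      push_cast
      linarith
  have hsum : ∀ n : ℕ, ∑ j ∈ Finset.range (n + 1), t j = t n ^ 2 := by
    intro n
    induction n with
    | zero => simp [h0]
    | succ n ih =>
      rw [Finset.sum_range_succ, ih, hrec]
      have h1 := Real.sq_sqrt (show (0 : ℝ) ≤ 1 + 4 * t n ^ 2 by positivity)
      nlinarith
  obtain ⟨hν0, hν1⟩ := hν
  have hk : (0 : ℝ) < (k : ℝ) + 2 := by positivity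
  set P : ℝ := ((k : ℝ) + 2) ^ ((1 - ν) / (1 + ν)) with hP
  have hPpos : 0 < P := Real.rpow_pos_of_pos hk _
  have hpow : ((k : ℝ) + 2) ^ ((1 + 3 * ν) / (1 + ν)) = ((k : ℝ) + 2) ^ 2 / P := by
    have he : (1 + 3 * ν) / (1 + ν) = 2 - (1 - ν) / (1 + ν) := by
      have : 1 + ν ≠ 0 := by linarith
      field_simp
      ring
    rw [he, Real.rpow_sub hk, Real.rpow_two]
  have hterm : ∀ j ∈ Finset.range (k + 1), t j / (2 * P * Mbar) ≤ 1 / (M j * τ j) := by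
    intro j hj
    obtain ⟨h1, h2⟩ := hM j (by have := Finset.mem_range.mp hj; omega)
    have ht : 0 < t j := lt_of_lt_of_le (by positivity) (hge j)
    have : 1 / (M j * τ j) = t j / M j := by
      rw [hτ]
      field_simp
    rw [this]
    exact div_le_div_of_nonneg_left ht.le h1 h2
  refine le_trans ?_ (Finset.sum_le_sum hterm)
  rw [← Finset.sum_div, hsum, hpow]
  have hsq : (((k : ℝ) + 2) / 2) ^ 2 ≤ t k ^ 2 := pow_le_pow_left₀ (by positivity) (hge k) 2
  calc ((k : ℝ) + 2) ^ 2 / P / (8 * Mbar) = (((k : ℝ) + 2) / 2) ^ 2 / (2 * P * Mbar) := by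
        field_simp
        norm_num
    _ ≤ _ := div_le_div_of_nonneg_right hsq (by positivity)
end

section
/- Let K ⊆ ℝⁿ be nonempty, compact and convex, and define h(λ) := max_{r ∈ K} ⟨λ, r⟩. Let f : ℝ^p → ℝ, A : ℝ^p → ℝⁿ linear, b ∈ ℝⁿ, f* ∈ ℝ, x̄ ∈ ℝ^p, λ_0, λ* ∈ ℝⁿ, ε > 0, Ŝ > 0, ν ∈ [0,1], M̄ > 0 and k ∈ ℕ. Assume: (i) for every λ ∈ ℝⁿ, f(x̄) − f* ≤ ⟨b − A x̄, λ⟩ + h(λ) + ε/2 + (1/(2Ŝ))·‖λ − λ_0‖²; (ii) for every r ∈ K, f* ≤ f(x̄) + ⟨λ*, A x̄ − b − r⟩; (iii) Ŝ ≥ (k+2)^((1+3ν)/(1+ν)) / (8·M̄). Then dist(A x̄ − b, K) ≤ (1/Ŝ)·(2‖λ_0 − λ*‖ + √(Ŝ·ε)) ≤ 16·M̄·‖λ_0 − λ*‖/(k+2)^((1+3ν)/(1+ν)) + √(8·M̄·ε/(k+2)^((1+3ν)/(1+ν))). -/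
open scoped InnerProductSpace

/-- Feasibility-gap bound of Theorem 2 (AccUniPDGrad): under the averaged key primal
estimate, the saddle-point inequality, and `Ŝ ≥ (k+2)^((1+3ν)/(1+ν))/(8M̄)`, one has
`dist(Ax̄ − b, K) ≤ (1/Ŝ)(2‖λ_0 − λ*‖ + √(Ŝε))
  ≤ 16M̄‖λ_0 − λ*‖/(k+2)^((1+3ν)/(1+ν)) + √(8M̄ε/(k+2)^((1+3ν)/(1+ν)))`. -/
theorem accunipdgrad_feasibility_gap (p n : ℕ)
    (K : Set (EuclideanSpace ℝ (Fin n)))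
    (hKne : K.Nonempty) (hKcomp : IsCompact K) (hKconv : Convex ℝ K)
    (h : EuclideanSpace ℝ (Fin n) → ℝ)
    (hdef : ∀ lam : EuclideanSpace ℝ (Fin n),
      IsGreatest ((fun r => ⟪lam, r⟫_ℝ) '' K) (h lam))
    (f : EuclideanSpace ℝ (Fin p) → ℝ)
    (A : EuclideanSpace ℝ (Fin p) →ₗ[ℝ] EuclideanSpace ℝ (Fin n))
    (b : EuclideanSpace ℝ (Fin n)) (fstar : ℝ)
    (xbar : EuclideanSpace ℝ (Fin p))
    (lam0 lamstar : EuclideanSpace ℝ (Fin n))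
    (ε Shat ν Mbar : ℝ) (hε : 0 < ε) (hShat : 0 < Shat)
    (hν : ν ∈ Set.Icc (0 : ℝ) 1) (hMbar : 0 < Mbar) (k : ℕ)
    (h1 : ∀ lam : EuclideanSpace ℝ (Fin n),
      f xbar - fstar ≤ ⟪b - A xbar, lam⟫_ℝ + h lam + ε / 2
        + (1 / (2 * Shat)) * ‖lam - lam0‖ ^ 2)
    (h2 : ∀ r ∈ K, fstar ≤ f xbar + ⟪lamstar, A xbar - b - r⟫_ℝ)
    (h3 : ((k : ℝ) + 2) ^ ((1 + 3 * ν) / (1 + ν)) / (8 * Mbar) ≤ Shat) :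
    Metric.infDist (A xbar - b) K ≤
        (1 / Shat) * (2 * ‖lam0 - lamstar‖ + Real.sqrt (Shat * ε)) ∧
    (1 / Shat) * (2 * ‖lam0 - lamstar‖ + Real.sqrt (Shat * ε)) ≤
        16 * Mbar * ‖lam0 - lamstar‖ / ((k : ℝ) + 2) ^ ((1 + 3 * ν) / (1 + ν))
          + Real.sqrt (8 * Mbar * ε / ((k : ℝ) + 2) ^ ((1 + 3 * ν) / (1 + ν))) := by
  constructor
  · set u := A xbar - b with hu
    obtain ⟨r, hrK, hr⟩ := exists_norm_eq_iInf_of_complete_convex hKne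
      hKcomp.isComplete hKconv (u + (1 / Shat) • lam0)
    rw [norm_eq_iInf_iff_real_inner_le_zero hKconv hrK] at hr
    have hdist : Metric.infDist u K ≤ ‖u - r‖ := by
      rw [← dist_eq_norm]; exact Metric.infDist_le_dist_of_mem hrK
    refine hdist.trans ?_
    obtain ⟨⟨r', hr'K, hr'⟩, -⟩ := hdef (lam0 + Shat • (u - r))
    have e1 := h1 (lam0 + Shat • (u - r))
    have e2 := h2 r hrK
    have e3 := hr r' hr'K
    have hb : b - A xbar = -u := by rw [hu]; abel
    have hlam : u + (1 / Shat) • lam0 - r = (1 / Shat) • (lam0 + Shat • (u - r)) := by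
      rw [smul_add, smul_smul, one_div_mul_cancel hShat.ne', one_smul]; abel
    rw [hlam, real_inner_smul_left, inner_sub_right] at e3
    have e4 : ⟪lam0 + Shat • (u - r), r'⟫_ℝ ≤ ⟪lam0 + Shat • (u - r), r⟫_ℝ := by
      have : 0 < 1 / Shat := by positivity
      by_contra hc
      push Not at hc
      have := mul_pos this (sub_pos.2 hc)
      linarith
    have e5 : ⟪b - A xbar, lam0 + Shat • (u - r)⟫_ℝ + ⟪lam0 + Shat • (u - r), r⟫_ℝ
        = - ⟪lam0, u - r⟫_ℝ - Shat * ‖u - r‖ ^ 2 := by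
      rw [hb, inner_neg_left, real_inner_comm, neg_add_eq_sub, ← inner_sub_right,
        ← neg_sub u r, inner_neg_right, inner_add_left, real_inner_smul_left,
        real_inner_self_eq_norm_sq]
      ring
    have e6 : ‖lam0 + Shat • (u - r) - lam0‖ ^ 2 = Shat ^ 2 * ‖u - r‖ ^ 2 := by
      rw [add_sub_cancel_left, norm_smul, mul_pow, Real.norm_eq_abs, sq_abs]
    have e7 : (1 / (2 * Shat)) * (Shat ^ 2 * ‖u - r‖ ^ 2) = Shat / 2 * ‖u - r‖ ^ 2 := by
      field_simp
    have e8 : ⟪lamstar - lam0, u - r⟫_ℝ ≤ ‖lam0 - lamstar‖ * ‖u - r‖ := by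
      rw [norm_sub_rev lam0]; exact real_inner_le_norm _ _
    rw [inner_sub_left] at e8
    rw [e6, e7] at e1
    simp only at hr'
    have key : Shat * ‖u - r‖ ^ 2 ≤ 2 * ‖lam0 - lamstar‖ * ‖u - r‖ + ε := by linarith
    have hq := Real.sq_sqrt (mul_pos hShat hε).le
    have hq0 := Real.sqrt_pos.2 (mul_pos hShat hε)
    have hD := norm_nonneg (lam0 - lamstar)
    have hd := norm_nonneg (u - r)
    generalize √(Shat * ε) = q at *
    generalize ‖lam0 - lamstar‖ = D at *
    generalize ‖u - r‖ = d at *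
    rw [one_div, inv_mul_eq_div, le_div_iff₀ hShat]
    by_contra hc
    push Not at hc
    have k2 : (d * Shat) ^ 2 ≤ 2 * D * (d * Shat) + q ^ 2 := by
      rw [hq]; nlinarith
    nlinarith
  · have hP : 0 < ((k : ℝ) + 2) ^ ((1 + 3 * ν) / (1 + ν)) := by positivity
    generalize ((k : ℝ) + 2) ^ ((1 + 3 * ν) / (1 + ν)) = P at *
    have hS : 1 / Shat ≤ 8 * Mbar / P := by
      rw [div_le_div_iff₀ hShat hP]
      rw [div_le_iff₀ (by positivity)] at h3
      linarith
    have hs : (1 / Shat) * √(Shat * ε) = √((1 / Shat) * ε) := by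
      rw [show (1 / Shat) * ε = (1 / Shat) ^ 2 * (Shat * ε) by field_simp,
        Real.sqrt_mul (sq_nonneg (1 / Shat)), Real.sqrt_sq (by positivity)]
    rw [mul_add, hs]
    apply add_le_add
    · calc 1 / Shat * (2 * ‖lam0 - lamstar‖) ≤ 8 * Mbar / P * (2 * ‖lam0 - lamstar‖) := by gcongr
        _ = _ := by ring
    · apply Real.sqrt_le_sqrt
      calc 1 / Shat * ε ≤ 8 * Mbar / P * ε := by gcongr
        _ = _ := by ring
end

section
/- Let E and F be real inner product spaces, A : E → F a continuous linear map, b ∈ F, X ⊆ E a convex set, μ > 0, and f : E → ℝ strongly convex on X with parameter μ (i.e. f(α·x + β·y) ≤ α·f(x) + β·f(y) − (μ/2)·α·β·‖x − y‖² for all x, y ∈ X and α, β ≥ 0 with α + β = 1). For i = 1, 2, let λ_i ∈ F and let x_i ∈ X be a maximizer over X of the function x ↦ ⟨λ_i, b − A x⟩ − f(x). Then ‖x_1 − x_2‖ ≤ (‖A‖/μ)·‖λ_1 − λ_2‖ and ‖A x_1 − A x_2‖ ≤ (‖A‖²/μ)·‖λ_1 − λ_2‖. -/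
open scoped InnerProductSpace

theorem growth_aux
    {E F : Type*} [NormedAddCommGroup E] [InnerProductSpace ℝ E]
    [NormedAddCommGroup F] [InnerProductSpace ℝ F]
    (A : E →L[ℝ] F) (b : F) (X : Set E) (hX : Convex ℝ X)
    (μ : ℝ) (hμ : 0 < μ) (f : E → ℝ)
    (hsc : ∀ x ∈ X, ∀ y ∈ X, ∀ a c : ℝ, 0 ≤ a → 0 ≤ c → a + c = 1 →
      f (a • x + c • y) ≤ a * f x + c * f y - (μ / 2) * a * c * ‖x - y‖ ^ 2)
    (l : F) (x y : E) (hx : x ∈ X) (hy : y ∈ X)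
    (hmax : ∀ z ∈ X, ⟪l, b - A z⟫_ℝ - f z ≤ ⟪l, b - A x⟫_ℝ - f x) :
    μ / 2 * ‖x - y‖ ^ 2 ≤ (⟪l, b - A x⟫_ℝ - f x) - (⟪l, b - A y⟫_ℝ - f y) := by
  have key : ∀ t : ℝ, 0 < t → t < 1 → (1 - t) * (μ / 2 * ‖x - y‖ ^ 2) ≤
      (⟪l, b - A x⟫_ℝ - f x) - (⟪l, b - A y⟫_ℝ - f y) := by
    intro t h0 h1
    have h := hsc x hx y hy (1 - t) t (by linarith) h0.le (by ring)
    have h2 := hmax _ (hX hx hy (by linarith : 0 ≤ 1 - t) h0.le (by ring))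
    simp only [map_add, map_smul, inner_sub_right, inner_add_right, inner_smul_right] at h2 ⊢
    refine le_of_mul_le_mul_left ?_ h0
    linarith
  have hG := hmax y hy
  by_contra hlt
  push Not at hlt
  set K := μ / 2 * ‖x - y‖ ^ 2
  set G := (⟪l, b - A x⟫_ℝ - f x) - (⟪l, b - A y⟫_ℝ - f y) with hGdef
  have hG0 : 0 ≤ G := by rw [hGdef]; linarith
  have hK : 0 < K := by linarith
  have h := key ((K - G) / (2 * K)) (div_pos (by linarith) (by linarith))
    (by rw [div_lt_one (by linarith)]; linarith)
  have e : (1 - (K - G) / (2 * K)) * K = (K + G) / 2 := by field_simp; ring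
  linarith

/-- If `f` is `μ`-strongly convex on the convex set `X`, then the maximizers
`x_i = x*(λ_i)` of `x ↦ ⟨λ_i, b − Ax⟩ − f(x)` over `X` satisfy
`‖x_1 − x_2‖ ≤ (‖A‖/μ)‖λ_1 − λ_2‖` and `‖Ax_1 − Ax_2‖ ≤ (‖A‖²/μ)‖λ_1 − λ_2‖`;
i.e. the dual gradient is Lipschitz with constant `‖A‖²/μ`. -/
theorem strongly_convex_dual_lipschitz
    {E F : Type*} [NormedAddCommGroup E] [InnerProductSpace ℝ E]
    [NormedAddCommGroup F] [InnerProductSpace ℝ F]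
    (A : E →L[ℝ] F) (b : F) (X : Set E) (hX : Convex ℝ X)
    (μ : ℝ) (hμ : 0 < μ) (f : E → ℝ)
    (hsc : ∀ x ∈ X, ∀ y ∈ X, ∀ a c : ℝ, 0 ≤ a → 0 ≤ c → a + c = 1 →
      f (a • x + c • y) ≤ a * f x + c * f y - (μ / 2) * a * c * ‖x - y‖ ^ 2)
    (lam1 lam2 : F) (x1 x2 : E) (hx1 : x1 ∈ X) (hx2 : x2 ∈ X)
    (hmax1 : ∀ x ∈ X, ⟪lam1, b - A x⟫_ℝ - f x ≤ ⟪lam1, b - A x1⟫_ℝ - f x1)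
    (hmax2 : ∀ x ∈ X, ⟪lam2, b - A x⟫_ℝ - f x ≤ ⟪lam2, b - A x2⟫_ℝ - f x2) :
    ‖x1 - x2‖ ≤ (‖A‖ / μ) * ‖lam1 - lam2‖ ∧
    ‖A x1 - A x2‖ ≤ (‖A‖ ^ 2 / μ) * ‖lam1 - lam2‖ := by
  have g1 := growth_aux A b X hX μ hμ f hsc lam1 x1 x2 hx1 hx2 hmax1
  have g2 := growth_aux A b X hX μ hμ f hsc lam2 x2 x1 hx2 hx1 hmax2
  rw [norm_sub_rev x2 x1] at g2
  have hA : ‖A x1 - A x2‖ ≤ ‖A‖ * ‖x1 - x2‖ := by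
    rw [← map_sub]; exact A.le_opNorm _
  have hcs : ⟪lam1 - lam2, A x2 - A x1⟫_ℝ ≤ ‖lam1 - lam2‖ * ‖A x1 - A x2‖ := by
    rw [norm_sub_rev (A x1)]; exact real_inner_le_norm _ _
  have hs : μ * ‖x1 - x2‖ ^ 2 ≤ ⟪lam1 - lam2, A x2 - A x1⟫_ℝ := by
    simp only [inner_sub_right, inner_sub_left] at *
    linarith
  have hb := mul_le_mul_of_nonneg_left hA (norm_nonneg (lam1 - lam2))
  have main : ‖x1 - x2‖ ≤ (‖A‖ / μ) * ‖lam1 - lam2‖ := by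
    rcases (norm_nonneg (x1 - x2)).eq_or_lt with h | h
    · rw [← h]; positivity
    · rw [div_mul_eq_mul_div, le_div_iff₀ hμ]
      refine le_of_mul_le_mul_right ?_ h
      nlinarith
  refine ⟨main, hA.trans ((mul_le_mul_of_nonneg_left main (norm_nonneg A)).trans (le_of_eq ?_))⟩
  ring
end

section
/- Let E and F be real inner product spaces, A : E → F a continuous linear map with adjoint Aᵀ, X ⊆ E, μ > 0 and q ≥ 2. Let Df : E → E satisfy the uniform convexity (monotonicity) condition ⟨Df(x) − Df(y), x − y⟩ ≥ μ·‖x − y‖^q for all x, y ∈ X. For i = 1, 2, let λ_i ∈ F and x_i ∈ X satisfy the first-order optimality condition ⟨Aᵀλ_i + Df(x_i), x − x_i⟩ ≥ 0 for all x ∈ X. Then ‖x_1 − x_2‖^(q−1) ≤ (‖A‖/μ)·‖λ_1 − λ_2‖, and consequently ‖A x_1 − A x_2‖ ≤ ‖A‖ · ((‖A‖/μ)·‖λ_1 − λ_2‖)^(1/(q−1)); in particular the dual gradient ∇g(λ) = b − A x*(λ) is Hölder continuous with exponent ν = 1/(q−1). -/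
open scoped InnerProductSpace

/-- If `Df` (a subgradient selection of `f`) is uniformly monotone on `X` with parameter
`μ > 0` and degree `q ≥ 2`, and `x_i` satisfies the first-order optimality condition of
`max_{x ∈ X} ⟨λ_i, b − Ax⟩ − f(x)`, then `‖x_1 − x_2‖^(q−1) ≤ (‖A‖/μ)‖λ_1 − λ_2‖` and
`‖Ax_1 − Ax_2‖ ≤ ‖A‖·((‖A‖/μ)‖λ_1 − λ_2‖)^(1/(q−1))`; i.e. the dual gradient
`∇g(λ) = b − A x*(λ)` is Hölder continuous with exponent `ν = 1/(q−1)`. -/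
theorem uniformly_convex_dual_holder
    {E F : Type*} [NormedAddCommGroup E] [InnerProductSpace ℝ E] [CompleteSpace E]
    [NormedAddCommGroup F] [InnerProductSpace ℝ F] [CompleteSpace F]
    (A : E →L[ℝ] F) (X : Set E) (μ q : ℝ) (hμ : 0 < μ) (hq : 2 ≤ q)
    (Df : E → E)
    (hunif : ∀ x ∈ X, ∀ y ∈ X, μ * ‖x - y‖ ^ q ≤ ⟪Df x - Df y, x - y⟫_ℝ)
    (lam1 lam2 : F) (x1 x2 : E) (hx1 : x1 ∈ X) (hx2 : x2 ∈ X)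
    (hopt1 : ∀ x ∈ X, 0 ≤ ⟪ContinuousLinearMap.adjoint A lam1 + Df x1, x - x1⟫_ℝ)
    (hopt2 : ∀ x ∈ X, 0 ≤ ⟪ContinuousLinearMap.adjoint A lam2 + Df x2, x - x2⟫_ℝ) :
    ‖x1 - x2‖ ^ (q - 1) ≤ (‖A‖ / μ) * ‖lam1 - lam2‖ ∧
    ‖A x1 - A x2‖ ≤ ‖A‖ * ((‖A‖ / μ) * ‖lam1 - lam2‖) ^ (1 / (q - 1)) := by
  have hle : μ * ‖x1 - x2‖ ^ q ≤ ‖A‖ * ‖lam1 - lam2‖ * ‖x1 - x2‖ := by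
    have h1 := hopt1 x2 hx2
    have h2 := hopt2 x1 hx1
    have h3 := hunif x1 hx1 x2 hx2
    rw [inner_add_left, ContinuousLinearMap.adjoint_inner_left] at h1 h2
    have h4 : ⟪lam2 - lam1, A (x1 - x2)⟫_ℝ ≤ ‖lam1 - lam2‖ * (‖A‖ * ‖x1 - x2‖) := by
      refine (real_inner_le_norm _ _).trans ?_
      rw [norm_sub_rev lam2 lam1]
      exact mul_le_mul_of_nonneg_left (A.le_opNorm _) (norm_nonneg _)
    simp only [map_sub, inner_sub_left, inner_sub_right] at h1 h2 h3 h4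
    linarith
  have hfst : ‖x1 - x2‖ ^ (q - 1) ≤ (‖A‖ / μ) * ‖lam1 - lam2‖ := by
    rcases (norm_nonneg (x1 - x2)).eq_or_lt with h0 | h0
    · rw [← h0, Real.zero_rpow (by linarith)]
      positivity
    · have e : ‖x1 - x2‖ ^ q = ‖x1 - x2‖ ^ (q - 1) * ‖x1 - x2‖ := by
        rw [Real.rpow_sub_one h0.ne']
        field_simp
      rw [e, ← mul_assoc] at hle
      have h5 := le_of_mul_le_mul_right hle h0
      rw [div_mul_eq_mul_div, le_div_iff₀ hμ]
      linarith
  refine ⟨hfst, ?_⟩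
  rw [← map_sub]
  refine (A.le_opNorm _).trans (mul_le_mul_of_nonneg_left ?_ (norm_nonneg _))
  have h6 := Real.rpow_le_rpow (by positivity) hfst
    (show (0 : ℝ) ≤ 1 / (q - 1) from div_nonneg zero_le_one (by linarith))
  rwa [← Real.rpow_mul (norm_nonneg _), mul_one_div_cancel (by linarith), Real.rpow_one] at h6
end

section
/- Let c > 0, set c₁ := max(c, 1), and let M̄ > 0, ε > 0, k ∈ ℕ. If k + 1 ≥ (4·√2·c / (−1 + √(1 + 8·c/c₁)))² · (M̄/ε), then (4·M̄·c/(k+1) + √(2·M̄·ε/(k+1))) · c₁ ≤ ε. -/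
/-- Worst-case iteration-complexity computation for UniPDGrad: with `c = ‖λ*‖`,
`c₁ = max(c, 1)`, if `k + 1 ≥ (4√2·c/(−1 + √(1 + 8c/c₁)))²·(M̄/ε)` then
`(4M̄c/(k+1) + √(2M̄ε/(k+1)))·c₁ ≤ ε`. -/
theorem unipdgrad_complexity_bound (c Mbar ε : ℝ)
    (hc : 0 < c) (hMbar : 0 < Mbar) (hε : 0 < ε) (k : ℕ)
    (hk : (4 * Real.sqrt 2 * c / (-1 + Real.sqrt (1 + 8 * c / max c 1))) ^ 2 * (Mbar / ε) ≤
      (k : ℝ) + 1) :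
    (4 * Mbar * c / ((k : ℝ) + 1) + Real.sqrt (2 * Mbar * ε / ((k : ℝ) + 1))) * max c 1 ≤ ε := by
  have hm : 0 < max c 1 := lt_max_of_lt_left hc
  generalize max c 1 = m at *
  have hD : (0 : ℝ) < (k : ℝ) + 1 := by positivity
  generalize (k : ℝ) + 1 = D at *
  have hq : 0 < 8 * c / m := by positivity
  have hs : 1 < Real.sqrt (1 + 8 * c / m) := by
    rw [Real.lt_sqrt (by norm_num)]
    linarith
  have hs2 : Real.sqrt (1 + 8 * c / m) ^ 2 = 1 + 8 * c / m := Real.sq_sqrt (by linarith)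
  obtain ⟨t, ht⟩ : ∃ t, t = -1 + Real.sqrt (1 + 8 * c / m) := ⟨_, rfl⟩
  rw [← ht] at hk
  have ht0 : 0 < t := by linarith
  have htq : (t ^ 2 + 2 * t) * m = 8 * c := by
    have h : t ^ 2 + 2 * t = 8 * c / m := by
      rw [ht]
      linarith
    rw [h]
    field_simp
  have h2 : Real.sqrt 2 ^ 2 = 2 := Real.sq_sqrt (by norm_num)
  have key : 32 * c ^ 2 * Mbar ≤ t ^ 2 * ε * D := by
    have e : (4 * Real.sqrt 2 * c / t) ^ 2 * (Mbar / ε) = 32 * c ^ 2 * Mbar / (t ^ 2 * ε) := by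
      rw [div_pow, mul_pow, mul_pow, h2, div_mul_div_comm]
      norm_num
    rw [e, div_le_iff₀ (by positivity)] at hk
    linarith
  have a1 : 4 * Mbar * c / D ≤ t ^ 2 * ε / (8 * c) := by
    rw [div_le_div_iff₀ hD (by positivity)]
    linarith
  have a2 : Real.sqrt (2 * Mbar * ε / D) ≤ t * ε / (4 * c) := by
    apply Real.sqrt_le_iff.mpr
    refine ⟨by positivity, ?_⟩
    rw [div_pow, div_le_div_iff₀ hD (by positivity)]
    have := mul_le_mul_of_nonneg_right key hε.le
    linarith
  calc _ ≤ (t ^ 2 * ε / (8 * c) + t * ε / (4 * c)) * m :=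
        mul_le_mul_of_nonneg_right (add_le_add a1 a2) hm.le
    _ = ((t ^ 2 + 2 * t) * m) * ε / (8 * c) := by
        field_simp
        ring
    _ = ε := by
        rw [htq]
        field_simp
    _ ≤ ε := le_rfl
end

section
/- Let M₋₁ > 0, k ∈ ℕ, let i_0, …, i_k be natural numbers and M_0, …, M_k positive reals with M_0 = 2^(i_0 − 1)·M₋₁ and M_j = 2^(i_j − 1)·M_{j−1} for 1 ≤ j ≤ k. Then Σ_{j=0}^{k} (i_j + 1) = 2·(k+1) + log₂(M_k) − log₂(M₋₁). Moreover, if additionally M_k ≤ 2·M̄ for some M̄ > 0, then Σ_{j=0}^{k} (i_j + 1) ≤ 2·(k+1) + 1 + log₂(M̄) − log₂(M₋₁). -/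
/-- Oracle-complexity count `N₁(k)` for UniPDGrad: if `M_0 = 2^(i_0 − 1) M₋₁` and
`M_j = 2^(i_j − 1) M_{j−1}`, then `Σ_{j=0}^k (i_j + 1) = 2(k+1) + log₂ M_k − log₂ M₋₁`;
moreover if `M_k ≤ 2M̄` then `Σ_{j=0}^k (i_j + 1) ≤ 2(k+1) + 1 + log₂ M̄ − log₂ M₋₁`. -/
theorem oracle_query_count (Mm1 : ℝ) (hMm1 : 0 < Mm1)
    (k : ℕ) (i : ℕ → ℕ) (M : ℕ → ℝ)
    (hMpos : ∀ j ≤ k, 0 < M j)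
    (hM0 : M 0 = 2 ^ ((i 0 : ℤ) - 1) * Mm1)
    (hMj : ∀ j, 1 ≤ j → j ≤ k → M j = 2 ^ ((i j : ℤ) - 1) * M (j - 1)) :
    (∑ j ∈ Finset.range (k + 1), ((i j : ℝ) + 1)) =
      2 * ((k : ℝ) + 1) + Real.logb 2 (M k) - Real.logb 2 Mm1 ∧
    (∀ Mbar : ℝ, 0 < Mbar → M k ≤ 2 * Mbar →
      (∑ j ∈ Finset.range (k + 1), ((i j : ℝ) + 1)) ≤
        2 * ((k : ℝ) + 1) + 1 + Real.logb 2 Mbar - Real.logb 2 Mm1) := by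
  have key : ∀ (n : ℤ) (x : ℝ), 0 < x →
      Real.logb 2 (2 ^ n * x) = (n : ℝ) + Real.logb 2 x := by
    intro n x hx
    have h2 : (2 : ℝ) ^ n ≠ 0 := by positivity
    rw [Real.logb_mul h2 hx.ne', ← Real.rpow_intCast,
      Real.logb_rpow (by norm_num) (by norm_num)]
  have main : ∀ m, m ≤ k → (∑ j ∈ Finset.range (m + 1), ((i j : ℝ) + 1)) =
      2 * ((m : ℝ) + 1) + Real.logb 2 (M m) - Real.logb 2 Mm1 := by
    intro m
    induction m with
    | zero =>
      intro _
      rw [hM0, key _ _ hMm1]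
      simp
      ring
    | succ m ih =>
      intro hm
      have h1 := hMj (m + 1) (by omega) hm
      rw [Nat.add_sub_cancel] at h1
      rw [Finset.sum_range_succ, ih (by omega), h1, key _ _ (hMpos m (by omega))]
      push_cast
      ring
  refine ⟨main k le_rfl, ?_⟩
  intro Mbar hb hle
  rw [main k le_rfl]
  have h := Real.logb_le_logb_of_le (b := 2) (by norm_num) (hMpos k le_rfl) hle
  have h3 := key 1 Mbar hb
  rw [zpow_one] at h3
  push_cast at h3
  linarith
end
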